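/- For the KKM potential V_II, the integrals satisfy the vanishing Poisson bracket relations {A₁,A₂} = {A₁,B₂} = {A₂,B₁} = {B₁,F} = {B₂,F} = 0. -/

import Mathlib

noncomputable section

open MvPolynomial

/-- The field of rational functions over ℂ in the six variables
`x, y, z, p_x, p_y, p_z`: the fraction field of the polynomial ring. -/
abbrev K6 : Type := FractionRing (MvPolynomial (Fin 6) ℂ)

/-- The canonical embedding of the polynomial ring into its fraction field. -/
def toK6 : MvPolynomial (Fin 6) ℂ →+* K6 :=
  algebraMap (MvPolynomial (Fin 6) ℂ) K6

/-- Constants, embedded in `K6`. -/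
def cC (a : ℂ) : K6 := toK6 (MvPolynomial.C a)

/-- The imaginary unit `i`, embedded in `K6`. -/
def iC : K6 := cC Complex.I

def vx : K6 := toK6 (MvPolynomial.X 0)
def vy : K6 := toK6 (MvPolynomial.X 1)
def vz : K6 := toK6 (MvPolynomial.X 2)
def vpx : K6 := toK6 (MvPolynomial.X 3)
def vpy : K6 := toK6 (MvPolynomial.X 4)
def vpz : K6 := toK6 (MvPolynomial.X 5)

/-- `D` is the (unique) extension to the fraction field of the formal partial
derivative `pderiv j` on the polynomial ring: an additive map satisfying the
Leibniz rule which agrees with `pderiv j` on polynomials. -/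
def IsPDeriv (j : Fin 6) (D : K6 → K6) : Prop :=
  (∀ f g : K6, D (f + g) = D f + D g) ∧
  (∀ f g : K6, D (f * g) = D f * g + f * D g) ∧
  (∀ p, D (toK6 p) = toK6 (pderiv j p))

/-- The canonical Poisson bracket on `K6`, where `Pd 0, …, Pd 5` are the
partial derivatives with respect to `x, y, z, p_x, p_y, p_z` respectively:
`{f,g} = f_x g_{p_x} + f_y g_{p_y} + f_z g_{p_z}
  - f_{p_x} g_x - f_{p_y} g_y - f_{p_z} g_z`. -/
def poisson (Pd : Fin 6 → K6 → K6) (f g : K6) : K6 :=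
  Pd 0 f * Pd 3 g + Pd 1 f * Pd 4 g + Pd 2 f * Pd 5 g
    - Pd 3 f * Pd 0 g - Pd 4 f * Pd 1 g - Pd 5 f * Pd 2 g

/-- Angular momentum `J_x = y p_z - z p_y`. -/
def Jx : K6 := vy * vpz - vz * vpy
/-- Angular momentum `J_y = z p_x - x p_z`. -/
def Jy : K6 := vz * vpx - vx * vpz
/-- Angular momentum `J_z = x p_y - y p_x`. -/
def Jz : K6 := vx * vpy - vy * vpx
/-- Total angular momentum squared `J² = J_x² + J_y² + J_z²`. -/
def Jsq : K6 := Jx ^ 2 + Jy ^ 2 + Jz ^ 2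

/-- KKM V_II Hamiltonian. -/
def HV (α β γ δ : ℂ) : K6 :=
  vpx ^ 2 + vpy ^ 2 + vpz ^ 2 + cC α * (vx ^ 2 + vy ^ 2 + vz ^ 2)
    + cC β * (vx - iC * vy) / (vx + iC * vy) ^ 3
    + cC γ / (vx + iC * vy) ^ 2 + cC δ / vz ^ 2

def A1V (α δ : ℂ) : K6 := vpz ^ 2 + cC α * vz ^ 2 + cC δ / vz ^ 2

def A2V (β γ : ℂ) : K6 :=
  Jz ^ 2 + 2 * iC * vx * vy * (cC γ - 2 * cC β) / (vx + iC * vy) ^ 2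
    + 2 * cC γ * vx ^ 2 / (vx + iC * vy) ^ 2

def B1V (β γ δ : ℂ) : K6 :=
  Jsq
    + (vz ^ 2 * (cC β * (4 * vx * vy * (vy - iC * vx) + vz ^ 2 * (vx - iC * vy))
        + cC γ * (vx + iC * vy) * (2 * vx * (vx + iC * vy) + vz ^ 2))
      + cC δ * (vx - iC * vy) * (vx + iC * vy) ^ 4)
      / (vz ^ 2 * (vx + iC * vy) ^ 3)

def B2V (α β : ℂ) : K6 :=
  (vpx + iC * vpy) ^ 2 + cC α * (vx + iC * vy) ^ 2 - cC β / (vx + iC * vy) ^ 2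

def FV (β δ : ℂ) : K6 :=
  (Jy - iC * Jx) ^ 2
    + (cC δ * (vx + iC * vy) ^ 4 - cC β * vz ^ 4) / (vz ^ 2 * (vx + iC * vy) ^ 2)

namespace IsPDeriv

variable {j : Fin 6} {D : K6 → K6}

theorem map_add (h : IsPDeriv j D) (f g : K6) : D (f + g) = D f + D g := h.1 f g

theorem map_mul (h : IsPDeriv j D) (f g : K6) : D (f * g) = D f * g + f * D g := h.2.1 f g

theorem map_sub (h : IsPDeriv j D) (f g : K6) : D (f - g) = D f - D g := by
  rw [eq_sub_iff_add_eq, ← h.map_add, sub_add_cancel]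

theorem map_const (h : IsPDeriv j D) (a : ℂ) : D (cC a) = 0 := by
  rw [cC, h.2.2, pderiv_C, map_zero]

theorem map_one (h : IsPDeriv j D) : D 1 = 0 := by
  simpa [cC] using h.map_const 1

theorem map_natCast (h : IsPDeriv j D) (n : ℕ) : D n = 0 := by
  rw [← _root_.map_natCast toK6, h.2.2, Derivation.map_natCast, map_zero]

theorem map_ofNat (h : IsPDeriv j D) (n : ℕ) [n.AtLeastTwo] : D (ofNat(n) : K6) = 0 :=
  h.map_natCast n

theorem map_var (h : IsPDeriv j D) (k : Fin 6) :
    D (toK6 (X k)) = if k = j then 1 else 0 := by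
  rw [h.2.2, pderiv_X, Pi.single_apply]
  split_ifs
  · exact _root_.map_one toK6
  · exact map_zero toK6

theorem map_pow (h : IsPDeriv j D) (f : K6) (n : ℕ) :
    D (f ^ n) = n * f ^ (n - 1) * D f := by
  induction n with
  | zero => simp [h.map_one]
  | succ n ih =>
    rw [pow_succ, h.map_mul, ih]
    rcases n with _ | n
    · simp
    · simp only [Nat.add_sub_cancel]
      push_cast
      ring

theorem map_div (h : IsPDeriv j D) (f : K6) {g : K6} (hg : g ≠ 0) :
    D (f / g) = (D f * g - f * D g) / g ^ 2 := by
  have key := h.map_mul (f / g) g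
  rw [div_mul_cancel₀ f hg] at key
  rw [key]
  field_simp
  ring

end IsPDeriv

theorem toK6_injective : Function.Injective toK6 :=
  IsFractionRing.injective (MvPolynomial (Fin 6) ℂ) K6

theorem vz_ne_zero : vz ≠ 0 :=
  (map_ne_zero_iff toK6 toK6_injective).2 (X_ne_zero 2)

theorem vx_add_iC_mul_vy_ne_zero : vx + iC * vy ≠ 0 := by
  rw [vx, iC, vy, cC, ← map_mul, ← map_add, map_ne_zero_iff toK6 toK6_injective]
  intro h
  simpa using congrArg (eval (Pi.single 0 1)) h

theorem iC_sq : iC ^ 2 = -1 := by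
  rw [iC, cC, ← map_pow, ← map_pow, Complex.I_sq, map_neg, map_neg, map_one, map_one]

set_option maxHeartbeats 1000000 in
theorem kkm_VII_vanishing_brackets (α β γ δ : ℂ) (Pd : Fin 6 → K6 → K6)
    (hPd : ∀ j, IsPDeriv j (Pd j))
    (H A1 A2 B1 B2 F : K6)
    (hH : H = HV α β γ δ) (hA1 : A1 = A1V α δ) (hA2 : A2 = A2V β γ)
    (hB1 : B1 = B1V β γ δ) (hB2 : B2 = B2V α β) (hF : F = FV β δ) :
    poisson Pd A1 A2 = 0 ∧ poisson Pd A1 B2 = 0 ∧ poisson Pd A2 B1 = 0 ∧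
      poisson Pd B1 F = 0 ∧ poisson Pd B2 F = 0 := by
  subst hH hA1 hA2 hB1 hB2 hF
  have hz := vz_ne_zero
  have hw := vx_add_iC_mul_vy_ne_zero
  have hI := iC_sq
  have hI3 : iC ^ 3 = -iC := by linear_combination iC * hI
  have hI4 : iC ^ 4 = 1 := by linear_combination (iC ^ 2 - 1) * hI
  have hI5 : iC ^ 5 = iC := by linear_combination iC * hI4
  have hI6 : iC ^ 6 = -1 := by linear_combination iC ^ 2 * hI4 + hI
  have hc (j : Fin 6) (a : ℂ) : Pd j (cC a) = 0 := (hPd j).map_const a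
  have hi (j : Fin 6) : Pd j iC = 0 := hc j _
  have h2 (j : Fin 6) : Pd j 2 = 0 := (hPd j).map_ofNat 2
  have h4 (j : Fin 6) : Pd j 4 = 0 := (hPd j).map_ofNat 4
  have hx (j : Fin 6) : Pd j vx = if 0 = j then 1 else 0 := (hPd j).map_var 0
  have hy (j : Fin 6) : Pd j vy = if 1 = j then 1 else 0 := (hPd j).map_var 1
  have hvz (j : Fin 6) : Pd j vz = if 2 = j then 1 else 0 := (hPd j).map_var 2
  have hpx (j : Fin 6) : Pd j vpx = if 3 = j then 1 else 0 := (hPd j).map_var 3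
  have hpy (j : Fin 6) : Pd j vpy = if 4 = j then 1 else 0 := (hPd j).map_var 4
  have hpz (j : Fin 6) : Pd j vpz = if 5 = j then 1 else 0 := (hPd j).map_var 5
  have hadd (j : Fin 6) := (hPd j).map_add
  have hsub (j : Fin 6) := (hPd j).map_sub
  have hmul (j : Fin 6) := (hPd j).map_mul
  have hpow (j : Fin 6) := (hPd j).map_pow
  have hdz (j : Fin 6) (f : K6) := (hPd j).map_div f (pow_ne_zero 2 hz)
  have hdw (j : Fin 6) (f : K6) := (hPd j).map_div f (pow_ne_zero 2 hw)
  have hdzw2 (j : Fin 6) (f : K6) :=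
    (hPd j).map_div f (mul_ne_zero (pow_ne_zero 2 hz) (pow_ne_zero 2 hw))
  have hdzw3 (j : Fin 6) (f : K6) :=
    (hPd j).map_div f (mul_ne_zero (pow_ne_zero 2 hz) (pow_ne_zero 3 hw))
  have hvy : vy = iC * (vx - (vx + iC * vy)) := by linear_combination vy * hI
  refine ⟨?_, ?_, ?_, ?_, ?_⟩ <;>
    simp only [poisson, A1V, A2V, B1V, B2V, FV, Jsq, Jx, Jy, Jz, hadd, hsub, hpow,
      hdz, hdw, hdzw2, hdzw3, hmul, hc, hi, h2, h4, hx, hy, hvz, hpx, hpy, hpz, Fin.reduceEq,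
      if_true, if_false, mul_zero, zero_mul, mul_one, one_mul, zero_div, add_zero, zero_add,
      sub_zero, sub_self, zero_sub, Nat.cast_ofNat, Nat.reduceSub, pow_one]
  all_goals
    generalize vx + iC * vy = w at hw hvy ⊢
    rw [hvy]
    field_simp
    ring_nf
    simp only [hI, hI3, hI4, hI5, hI6]
    ring
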